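/- Under the stated hypotheses, for every λ ∈ D: ‖r − r̄‖²_W ≤ 6θ₂² · (2T(λ)² + 2‖∇d*‖²_{W⁻¹}) · (1 + 6θ₁²/σ) · ‖∇⁺d(λ)‖_W · ‖λ − λ̄‖_W, where r = [λ]_Λ^W, r̄ = [r]_{Λ*}^W, λ̄ = [λ]_{Λ*}^W and T(λ) = max_{λ* ∈ Λ*} ‖λ − λ*‖_W. -/

import Mathlib

noncomputable section
open Finset

/-- Euclidean inner product on `Fin m → ℝ`. -/
def ipV {m : ℕ} (x y : Fin m → ℝ) : ℝ := ∑ i, x i * y i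

/-- Euclidean norm on `Fin m → ℝ`. -/
def eNorm {m : ℕ} (x : Fin m → ℝ) : ℝ := Real.sqrt (∑ i, (x i) ^ 2)

/-- Weighted norm `‖x‖_W` for a diagonal weight vector `w` (positive entries). -/
def wNorm {m : ℕ} (w : Fin m → ℝ) (x : Fin m → ℝ) : ℝ := Real.sqrt (∑ i, w i * (x i) ^ 2)

/-- Weighted norm `‖x‖_W = √(xᵀWx)` for a matrix `W`. -/
def mNorm {m : ℕ} (W : Matrix (Fin m) (Fin m) ℝ) (x : Fin m → ℝ) : ℝ :=
  Real.sqrt (ipV x (W.mulVec x))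

/-- The set `D = ℝ^p × ℝ^q_{≥0}` inside `Fin (p+q) → ℝ`. -/
def Dpq (p q : ℕ) : Set (Fin (p + q) → ℝ) := {x | ∀ i : Fin (p + q), p ≤ (i : ℕ) → 0 ≤ x i}

/-- Componentwise (Euclidean, equivalently `W`-weighted for diagonal `W`) projection onto
`Dpq p q`: the first `p` coordinates are unchanged, positive parts on the last `q`. -/
def projDpq (p q : ℕ) (v : Fin (p + q) → ℝ) : Fin (p + q) → ℝ :=
  fun i => if (i : ℕ) < p then v i else max (v i) 0

lemma aux_ipV_sub_right {m : ℕ} (a b c : Fin m → ℝ) : ipV a (b - c) = ipV a b - ipV a c := by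
  simp [ipV, mul_sub, Finset.sum_sub_distrib]

lemma aux_ipV_sub_left {m : ℕ} (a b c : Fin m → ℝ) : ipV (a - b) c = ipV a c - ipV b c := by
  simp [ipV, sub_mul, Finset.sum_sub_distrib]

lemma aux_wNorm_nonneg {m : ℕ} (w x : Fin m → ℝ) : 0 ≤ wNorm w x := Real.sqrt_nonneg _

lemma aux_wNorm_sq {m : ℕ} (w x : Fin m → ℝ) (hw : ∀ i, 0 < w i) :
    wNorm w x ^ 2 = ipV (fun i => w i * x i) x := by
  unfold wNorm ipV
  rw [Real.sq_sqrt (Finset.sum_nonneg fun i _ => mul_nonneg (hw i).le (sq_nonneg _))]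
  exact Finset.sum_congr rfl fun i _ => by ring

lemma aux_eNorm_sq {m : ℕ} (x : Fin m → ℝ) : eNorm x ^ 2 = ∑ i, x i ^ 2 := by
  unfold eNorm
  rw [Real.sq_sqrt (Finset.sum_nonneg fun i _ => sq_nonneg _)]

lemma aux_cs {m : ℕ} (w a b : Fin m → ℝ) (hw : ∀ i, 0 < w i) :
    ipV a b ≤ wNorm (fun i => (w i)⁻¹) a * wNorm w b := by
  have h := Real.sum_mul_le_sqrt_mul_sqrt Finset.univ
    (fun i => a i / Real.sqrt (w i)) (fun i => Real.sqrt (w i) * b i)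
  have e1 : ∀ i, a i / Real.sqrt (w i) * (Real.sqrt (w i) * b i) = a i * b i := fun i => by
    have := (Real.sqrt_pos.2 (hw i)).ne'
    field_simp
  have e2 : ∀ i, (a i / Real.sqrt (w i)) ^ 2 = (w i)⁻¹ * a i ^ 2 := fun i => by
    rw [div_pow, Real.sq_sqrt (hw i).le]; ring
  have e3 : ∀ i, (Real.sqrt (w i) * b i) ^ 2 = w i * b i ^ 2 := fun i => by
    rw [mul_pow, Real.sq_sqrt (hw i).le]
  simp only [e1, e2, e3] at h
  exact h

lemma aux_wNorm_dual {m : ℕ} (w a : Fin m → ℝ) (hw : ∀ i, 0 < w i) :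
    wNorm (fun i => (w i)⁻¹) (fun i => w i * a i) = wNorm w a := by
  unfold wNorm
  congr 1
  refine Finset.sum_congr rfl fun i _ => ?_
  have := (hw i).ne'
  field_simp

lemma aux_wNorm_symm {m : ℕ} (w a b : Fin m → ℝ) : wNorm w (a - b) = wNorm w (b - a) := by
  unfold wNorm
  congr 1
  refine Finset.sum_congr rfl fun i _ => ?_
  simp only [Pi.sub_apply]; ring

lemma aux_proj {p q : ℕ} (W : Fin (p + q) → ℝ) (hW : ∀ i, 0 < W i)
    (lam gr z : Fin (p + q) → ℝ) (hz : z ∈ Dpq p q) (e : Fin (p + q) → ℝ)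
    (he : e = projDpq p q (lam + fun i => (W i)⁻¹ * gr i) - lam) :
    ipV (gr - fun i => W i * e i) (z - lam - e) ≤ 0 := by
  unfold ipV
  refine Finset.sum_nonpos fun i _ => ?_
  have hi := hW i
  have hei : e i = (if (i : ℕ) < p then lam i + (W i)⁻¹ * gr i
    else max (lam i + (W i)⁻¹ * gr i) 0) - lam i := by rw [he]; rfl
  obtain ⟨y, hy⟩ : ∃ y, y = (W i)⁻¹ * gr i := ⟨_, rfl⟩
  have hg : gr i = W i * y := by rw [hy]; field_simp
  rw [← hy] at hei
  simp only [Pi.sub_apply]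
  rw [hg, ← mul_sub, mul_assoc]
  refine mul_nonpos_of_nonneg_of_nonpos hi.le ?_
  split_ifs at hei with h
  · have : y - e i = 0 := by rw [hei]; ring
    rw [this, zero_mul]
  · have hzi := hz i (not_lt.1 h)
    rcases le_total (lam i + y) 0 with h0 | h0
    · rw [max_eq_right h0] at hei
      rw [hei]; nlinarith
    · rw [max_eq_left h0] at hei
      rw [hei]; nlinarith

lemma aux_strong {n m : ℕ} (σ : ℝ) (ψ : (Fin n → ℝ) → ℝ)
    (hconv : ConvexOn ℝ Set.univ (fun x => ψ x - σ / 2 * (eNorm x) ^ 2))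
    (hdiff : Differentiable ℝ ψ)
    (G : Matrix (Fin m) (Fin n) ℝ) (g : Fin m → ℝ)
    (d : (Fin m → ℝ) → ℝ)
    (hd : ∀ lam, d lam = -ψ (-(G.transpose.mulVec lam)) - ipV g lam)
    (gradD : (Fin m → ℝ) → (Fin m → ℝ))
    (hgradD : ∀ lam v, fderiv ℝ d lam v = ipV (gradD lam) v) (a b : Fin m → ℝ) :
    σ * eNorm (G.transpose.mulVec a - G.transpose.mulVec b) ^ 2
      ≤ ipV (gradD a - gradD b) (b - a) := by
  have hdd : Differentiable ℝ d := by
    have : d = fun lam => -ψ (-(G.transpose.mulVecLin.toContinuousLinearMap lam)) - ∑ i, g i * lam i := by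
      funext lam; exact hd lam
    rw [this]
    fun_prop
  set v := b - a with hv
  set A := G.transpose.mulVec a with hA
  set V := G.transpose.mulVec v with hV
  have hlin : ∀ t : ℝ, G.transpose.mulVec (a + t • v) = A + t • V := fun t => by
    rw [Matrix.mulVec_add, Matrix.mulVec_smul]
  set φ : ℝ → ℝ := fun t => -d (a + t • v) - (ipV g a + t * ipV g v)
    - σ / 2 * ∑ i, (A i + t * V i) ^ 2 with hφ
  have hφeq : φ = (fun x => ψ x - σ / 2 * (eNorm x) ^ 2) ∘ (AffineMap.lineMap (-A) (-A - V)) := by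
    funext t
    have e1 : (AffineMap.lineMap (-A) (-A - V) : ℝ →ᵃ[ℝ] _) t = -(A + t • V) := by
      rw [AffineMap.lineMap_apply]; ext i; simp; ring
    have e2 : ipV g (a + t • v) = ipV g a + t * ipV g v := by
      simp only [ipV, Finset.mul_sum, ← Finset.sum_add_distrib, Pi.add_apply, Pi.smul_apply, smul_eq_mul]
      exact Finset.sum_congr rfl fun i _ => by ring
    simp only [hφ, Function.comp, e1, hd, hlin, aux_eNorm_sq, e2]
    simp only [Pi.neg_apply, Pi.add_apply, Pi.smul_apply, smul_eq_mul, neg_sq]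
    ring
  have hφc : ConvexOn ℝ Set.univ φ := by
    rw [hφeq]; exact hconv.comp_affineMap _
  have hder : ∀ t, HasDerivAt φ (-ipV (gradD (a + t • v)) v - ipV g v
      - σ / 2 * ∑ i, 2 * (A i + t * V i) * V i) t := by
    intro t
    have h1 : HasDerivAt (fun t : ℝ => a + t • v) v t := by
      simpa using ((hasDerivAt_id t).smul_const v).const_add a
    have h2 : HasDerivAt (fun t : ℝ => d (a + t • v)) (ipV (gradD (a + t • v)) v) t := by
      rw [← hgradD]
      exact (hdd _).hasFDerivAt.comp_hasDerivAt t h1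
    have h3 : HasDerivAt (fun t : ℝ => ipV g a + t * ipV g v) (ipV g v) t := by
      simpa using ((hasDerivAt_id t).mul_const (ipV g v)).const_add (ipV g a)
    have h4 : HasDerivAt (fun t : ℝ => ∑ i, (A i + t * V i) ^ 2)
        (∑ i, 2 * (A i + t * V i) * V i) t := by
      refine HasDerivAt.fun_sum fun i _ => ?_
      have h5 : HasDerivAt (fun t : ℝ => A i + t * V i) (V i) t := by
        simpa using ((hasDerivAt_id t).mul_const (V i)).const_add (A i)
      simpa using h5.fun_pow 2
    exact (h2.neg.sub h3).sub (h4.const_mul _)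
  have hmono := hφc.monotoneOn_deriv (fun x _ => (hder x).differentiableAt)
    (Set.mem_univ 0) (Set.mem_univ 1) zero_le_one
  rw [(hder 0).deriv, (hder 1).deriv] at hmono
  have hb : a + (1 : ℝ) • v = b := by simp [hv]
  have ha : a + (0 : ℝ) • v = a := by simp
  rw [ha, hb] at hmono
  have hB : A - G.transpose.mulVec b = -V := by
    rw [hV, hv, Matrix.mulVec_sub]; simp [hA]
  rw [hB, aux_eNorm_sq, aux_ipV_sub_left]
  have hs : ∑ i, 2 * (A i + 1 * V i) * V i
      = ∑ i, 2 * (A i + 0 * V i) * V i + 2 * ∑ i, (-V) i ^ 2 := by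
    rw [Finset.mul_sum, ← Finset.sum_add_distrib]
    exact Finset.sum_congr rfl fun i _ => by simp only [Pi.neg_apply]; ring
  rw [hs] at hmono
  linarith

lemma aux_real (A E N R S T σ θ₁ : ℝ) (hσ : 0 < σ) (hA : 0 ≤ A) (hE : 0 ≤ E)
    (hS : 0 ≤ S) (hAT : A ≤ T)
    (hEA : E ≤ 2 * A) (hR : σ * R ^ 2 ≤ θ₁ ^ 2 * (2 * A * E))
    (hSb : S ≤ N * E + N * R + (2 * A - E) * E) :
    S ^ 2 ≤ 6 * (2 * T ^ 2 + 2 * N ^ 2) * (1 + 6 * θ₁ ^ 2 / σ) * E * A := by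
  have hAE : 0 ≤ A * E := mul_nonneg hA hE
  have h0 : S ^ 2 ≤ (N * E + N * R + (2 * A - E) * E) ^ 2 := pow_le_pow_left₀ hS hSb 2
  have h1 : (N * E + N * R + (2 * A - E) * E) ^ 2
      ≤ 3 * ((N * E) ^ 2 + (N * R) ^ 2 + ((2 * A - E) * E) ^ 2) := by
    nlinarith [sq_nonneg (N * E - N * R), sq_nonneg (N * E - (2 * A - E) * E),
      sq_nonneg (N * R - (2 * A - E) * E)]
  have hE2 : E ^ 2 ≤ 2 * (A * E) := by nlinarith
  have hP0 : 0 ≤ (2 * A - E) * E := mul_nonneg (by linarith) hE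
  have hP1 : (2 * A - E) * E ≤ A ^ 2 := by nlinarith [sq_nonneg (A - E)]
  have hP2 : (2 * A - E) * E ≤ 2 * (A * E) := by nlinarith
  have hP : ((2 * A - E) * E) ^ 2 ≤ A ^ 2 * (2 * (A * E)) := by
    rw [sq]; exact mul_le_mul hP1 hP2 hP0 (sq_nonneg _)
  have hN : (N * E) ^ 2 ≤ N ^ 2 * (2 * (A * E)) := by
    rw [mul_pow]; exact mul_le_mul_of_nonneg_left hE2 (sq_nonneg _)
  have hR' : R ^ 2 ≤ θ₁ ^ 2 / σ * (2 * (A * E)) := by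
    rw [div_mul_eq_mul_div, le_div_iff₀ hσ]; linarith
  have hNR : (N * R) ^ 2 ≤ N ^ 2 * (θ₁ ^ 2 / σ * (2 * (A * E))) := by
    rw [mul_pow]; exact mul_le_mul_of_nonneg_left hR' (sq_nonneg _)
  have hc : 0 ≤ θ₁ ^ 2 / σ := by positivity
  rw [mul_div_assoc]
  set c := θ₁ ^ 2 / σ
  have hT2 : A ^ 2 ≤ T ^ 2 := pow_le_pow_left₀ hA hAT 2
  have k1 : A ^ 2 * (A * E) ≤ T ^ 2 * (A * E) := mul_le_mul_of_nonneg_right hT2 hAE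
  have k2 : 0 ≤ T ^ 2 * (A * E) := by positivity
  have k3 : 0 ≤ N ^ 2 * (A * E) := by positivity
  have k4 : 0 ≤ c * (T ^ 2 * (A * E)) := by positivity
  have k5 : 0 ≤ c * (N ^ 2 * (A * E)) := by positivity
  nlinarith

/-- Lemma: bound on `‖r − r̄‖²_W` with `r = [λ]_Λ^W`, `r̄ = [r]_{Λ*}^W`:
`‖r − r̄‖²_W ≤ 6θ₂²(2T(λ)² + 2‖∇d*‖²_{W⁻¹})(1 + 6θ₁²/σ) ‖∇⁺d(λ)‖_W ‖λ − λ̄‖_W`. -/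
theorem distance_face_to_optimal_bound
    (n p q : ℕ) (σ θ₁ θ₂ : ℝ) (hσ : 0 < σ) (hθ₁ : 0 < θ₁) (hθ₂ : 0 < θ₂)
    (ψ : (Fin n → ℝ) → ℝ)
    (hconv : ConvexOn ℝ Set.univ (fun x => ψ x - σ / 2 * (eNorm x) ^ 2))
    (hdiff : Differentiable ℝ ψ)
    (G : Matrix (Fin (p + q)) (Fin n) ℝ) (g : Fin (p + q) → ℝ)
    (W : Fin (p + q) → ℝ) (hW : ∀ i, 0 < W i)
    (d : (Fin (p + q) → ℝ) → ℝ)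
    (hd : ∀ lam, d lam = -ψ (-(G.transpose.mulVec lam)) - ipV g lam)
    (gradD : (Fin (p + q) → ℝ) → (Fin (p + q) → ℝ))
    (hgradD : ∀ lam v, fderiv ℝ d lam v = ipV (gradD lam) v)
    (Lstar : Set (Fin (p + q) → ℝ))
    (hLstar : ∀ l, l ∈ Lstar ↔ (l ∈ Dpq p q ∧ ∀ mu ∈ Dpq p q, d mu ≤ d l))
    (hLne : Lstar.Nonempty) (hLcl : IsClosed Lstar) (hLbd : Bornology.IsBounded Lstar)
    (ystar : Fin n → ℝ) (hystar : ∀ l ∈ Lstar, G.transpose.mulVec l = ystar)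
    (gdstar : Fin (p + q) → ℝ)
    (hgdstar : ∀ lam ∈ {lam | lam ∈ Dpq p q ∧ G.transpose.mulVec lam = ystar}, gradD lam = gdstar)
    (projL : (Fin (p + q) → ℝ) → (Fin (p + q) → ℝ))
    (hprojL : ∀ x, projL x ∈ {lam | lam ∈ Dpq p q ∧ G.transpose.mulVec lam = ystar} ∧
      ∀ s ∈ {lam | lam ∈ Dpq p q ∧ G.transpose.mulVec lam = ystar},
        wNorm W (projL x - x) ≤ wNorm W (s - x))
    (projLs : (Fin (p + q) → ℝ) → (Fin (p + q) → ℝ))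
    (hprojLs : ∀ x, projLs x ∈ Lstar ∧ ∀ s ∈ Lstar, wNorm W (projLs x - x) ≤ wNorm W (s - x))
    (hHoffman1 : ∀ lam ∈ Dpq p q,
      wNorm W (lam - projL lam) ≤ θ₁ * eNorm (G.transpose.mulVec lam - ystar))
    (hHoffman2 : ∀ ξ ∈ {lam | lam ∈ Dpq p q ∧ G.transpose.mulVec lam = ystar},
      wNorm W (ξ - projLs ξ) ≤ θ₂ * ipV gdstar (projLs ξ - ξ))
    (hnonexp : ∀ lam ∈ Dpq p q, ∀ om ∈ Dpq p q,
      wNorm (fun i => (W i)⁻¹) (gradD lam - gradD om) ≤ wNorm W (lam - om))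
    (hfix : ∀ l ∈ Lstar, projDpq p q (l + fun i => (W i)⁻¹ * gradD l i) - l = 0) :
    ∀ lam ∈ Dpq p q,
      (wNorm W (projL lam - projLs (projL lam))) ^ 2 ≤
        6 * θ₂ ^ 2 *
          (2 * (sSup ((fun l => wNorm W (lam - l)) '' Lstar)) ^ 2 +
            2 * (wNorm (fun i => (W i)⁻¹) gdstar) ^ 2) *
          (1 + 6 * θ₁ ^ 2 / σ) *
          wNorm W (projDpq p q (lam + fun i => (W i)⁻¹ * gradD lam i) - lam)
          * wNorm W (lam - projLs lam) := by
  intro lam hlam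
  set lb := projLs lam with hlb
  set r := projL lam with hr
  set rb := projLs r with hrb
  set e := projDpq p q (lam + fun i => (W i)⁻¹ * gradD lam i) - lam with he
  have hlbL : lb ∈ Lstar := (hprojLs lam).1
  have hrbL : rb ∈ Lstar := (hprojLs r).1
  have hLD : ∀ l ∈ Lstar, l ∈ Dpq p q := fun l hl => ((hLstar l).1 hl).1
  have hgl : ∀ l ∈ Lstar, gradD l = gdstar := fun l hl => hgdstar l ⟨hLD l hl, hystar l hl⟩
  have hopt : ∀ l ∈ Lstar, ∀ z ∈ Dpq p q, ipV gdstar (z - l) ≤ 0 := by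
    intro l hl z hz
    have := aux_proj W hW l (gradD l) z hz 0 (hfix l hl).symm
    rw [hgl l hl] at this
    convert this using 2
    · ext i; simp
    · simp
  -- the projected point lies in D
  have huD : lam + e ∈ Dpq p q := by
    intro i hi
    have : (lam + e) i = max (lam i + (W i)⁻¹ * gradD lam i) 0 := by
      rw [he, add_sub_cancel]; simp [projDpq, not_lt.2 hi]
    rw [this]; exact le_max_right _ _
  have hp := aux_proj W hW lam (gradD lam) lb (hLD lb hlbL) e he
  have ho := hopt lb hlbL _ huD
  have hstr := aux_strong σ ψ hconv hdiff G g d hd gradD hgradD lam lb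
  rw [hystar lb hlbL, hgl lb hlbL] at hstr
  have hnon := hnonexp lam hlam lb (hLD lb hlbL)
  rw [hgl lb hlbL] at hnon
  have hEsq := aux_wNorm_sq W e hW
  have c1 := aux_cs W (gradD lam - gdstar) e hW
  have c2 := aux_cs W (fun i => W i * e i) (lb - lam) hW
  rw [aux_wNorm_dual W e hW, aux_wNorm_symm W lb lam] at c2
  have c3 := aux_cs W gdstar e hW
  have c4 := aux_cs W gdstar (lam - r) hW
  have hH1 := hHoffman1 lam hlam
  rw [← hr] at hH1
  have hrmem := (hprojL lam).1
  rw [← hr] at hrmem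
  have hH2 := hHoffman2 r hrmem
  rw [← hrb] at hH2
  have o1 := hopt rb hrbL lb (hLD lb hlbL)
  have o2 := hopt lb hlbL rb (hLD rb hrbL)
  have hA0 := aux_wNorm_nonneg W (lam - lb)
  have hE0 := aux_wNorm_nonneg W e
  have hR0 := aux_wNorm_nonneg W (lam - r)
  have hX0 := aux_wNorm_nonneg W (r - rb)
  have hAT : wNorm W (lam - lb) ≤ sSup ((fun l => wNorm W (lam - l)) '' Lstar) := by
    refine le_csSup ?_ ⟨lb, hlbL, rfl⟩
    have hc : IsCompact Lstar := Metric.isCompact_of_isClosed_isBounded hLcl hLbd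
    refine (hc.image ?_).bddAbove
    unfold wNorm
    simp only [Pi.sub_apply]
    fun_prop
  have c1' : ipV (gradD lam - gdstar) e ≤ wNorm W (lam - lb) * wNorm W e :=
    c1.trans (mul_le_mul_of_nonneg_right hnon hE0)
  have hadd : ipV gdstar (lam + e - lb) = ipV gdstar lam + ipV gdstar e - ipV gdstar lb := by
    rw [aux_ipV_sub_right]
    congr 1
    simp [ipV, mul_add, Finset.sum_add_distrib]
  rw [hadd] at ho
  simp only [aux_ipV_sub_left, aux_ipV_sub_right] at hp hstr c1' c2 c4 hH2 o1 o2
  set A := wNorm W (lam - lb)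
  set E := wNorm W e
  set N := wNorm (fun i => (W i)⁻¹) gdstar
  set R := wNorm W (lam - r)
  set X := wNorm W (r - rb)
  set T := sSup ((fun l => wNorm W (lam - l)) '' Lstar)
  set Y := eNorm (G.transpose.mulVec lam - ystar)
  have hY0 : 0 ≤ σ * Y ^ 2 := by positivity
  have hYb : σ * Y ^ 2 ≤ 2 * A * E - E ^ 2 := by linarith
  have hEA : E ≤ 2 * A := by
    rcases hE0.eq_or_lt with h | h
    · rw [← h]; linarith
    · nlinarith
  have hR : σ * R ^ 2 ≤ θ₁ ^ 2 * (2 * A * E) := by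
    have h1 : R ^ 2 ≤ (θ₁ * Y) ^ 2 := pow_le_pow_left₀ hR0 hH1 2
    have h2 : θ₁ ^ 2 * (σ * Y ^ 2) ≤ θ₁ ^ 2 * (2 * A * E) :=
      mul_le_mul_of_nonneg_left (by nlinarith) (sq_nonneg _)
    nlinarith
  have hS : 0 ≤ ipV gdstar rb - ipV gdstar r := by
    by_contra h
    have := mul_neg_of_pos_of_neg hθ₂ (not_le.1 h)
    linarith
  have key := aux_real A E N R (ipV gdstar rb - ipV gdstar r) T σ θ₁ hσ hA0 hE0 hS hAT hEA hR
    (by linarith)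
  have hX : X ^ 2 ≤ (θ₂ * (ipV gdstar rb - ipV gdstar r)) ^ 2 := pow_le_pow_left₀ hX0 hH2 2
  rw [mul_pow] at hX
  have := mul_le_mul_of_nonneg_left key (sq_nonneg θ₂)
  linarith
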